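/- For every n ≥ 1 and every toll matrix T, the Segments Compensated Sharing allocation belongs to the core of the segments allocation game: f^{Sc}(N,T) ∈ C(N, v^{Se}). -/

import Mathlib

open Finset

/-- `T` is an `n × n` one-way toll matrix on the segments `{1, …, n}`:
entries are nonnegative, entries below the diagonal vanish, and entries
outside `{1,…,n} × {1,…,n}` vanish. -/
def IsTollMatrix (n : ℕ) (T : ℕ → ℕ → ℝ) : Prop :=
  (∀ h k, 0 ≤ T h k) ∧ (∀ h k, k < h → T h k = 0) ∧
    (∀ h k, h < 1 ∨ n < h ∨ k < 1 ∨ n < k → T h k = 0)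
/-- The Segments Compensated Sharing (SCS) method. -/
noncomputable def SCS (n : ℕ) (T : ℕ → ℕ → ℝ) (i : ℕ) : ℝ :=
  (1 / (n : ℝ)) *
    (((i : ℝ) - 1) * (∑ k ∈ Finset.Icc i n, T i k) +
      (∑ h ∈ Finset.Icc 1 i, ∑ k ∈ Finset.Icc i n, T h k) +
      ((n : ℝ) - (i : ℝ)) * (∑ h ∈ Finset.Icc 1 i, T h i))
/-- The segments allocation game: `v^{Se}(S) = Σ_{h≤k, 𝒫([h,k]) ⊆ S} t_{hk}`. -/
def vSe (n : ℕ) (T : ℕ → ℕ → ℝ) (S : Finset ℕ) : ℝ :=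
  ∑ h ∈ Finset.Icc 1 n, ∑ k ∈ Finset.Icc h n, if Finset.Icc h k ⊆ S then T h k else 0
/-- The core of the TU-game `v` on player set `{1,…,n}`. -/
def InCore (n : ℕ) (v : Finset ℕ → ℝ) (x : ℕ → ℝ) : Prop :=
  (∑ i ∈ Finset.Icc 1 n, x i = v (Finset.Icc 1 n)) ∧
    ∀ S ⊆ Finset.Icc 1 n, v S ≤ ∑ i ∈ S, x i

/-- Share of segment `i` in the trip `[h,k]`. -/
noncomputable def wgt (n i h k : ℕ) : ℝ :=
  (1 / (n : ℝ)) * ((if i = h then (i : ℝ) - 1 else 0) + (if h ≤ i ∧ i ≤ k then 1 else 0) +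
    (if i = k then (n : ℝ) - i else 0))

lemma wgt_nonneg (n i h k : ℕ) (hi : 1 ≤ i) (hin : i ≤ n) : 0 ≤ wgt n i h k := by
  have h1 : (1 : ℝ) ≤ i := by exact_mod_cast hi
  have h2 : (i : ℝ) ≤ n := by exact_mod_cast hin
  unfold wgt
  apply mul_nonneg (by positivity)
  split_ifs <;> linarith

lemma wgt_sum (n h k : ℕ) (S : Finset ℕ) (hn : 1 ≤ n) (hhk : h ≤ k)
    (hS : Finset.Icc h k ⊆ S) : ∑ i ∈ S, wgt n i h k = 1 := by
  have hn0 : (n : ℝ) ≠ 0 := by positivity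
  have hh : h ∈ S := hS (by simp [hhk])
  have hk : k ∈ S := hS (by simp [hhk])
  have hmid : ∑ i ∈ S, (if h ≤ i ∧ i ≤ k then (1 : ℝ) else 0) = k + 1 - h := by
    rw [← Finset.sum_filter]
    have : S.filter (fun i => h ≤ i ∧ i ≤ k) = Finset.Icc h k := by
      ext i
      simp only [Finset.mem_filter, Finset.mem_Icc]
      exact ⟨fun x => x.2, fun x => ⟨hS (Finset.mem_Icc.2 x), x⟩⟩
    rw [this]
    simp only [Finset.sum_const, Nat.card_Icc, nsmul_eq_mul, mul_one]
    rw [Nat.cast_sub (by omega)]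
    push_cast
    ring
  unfold wgt
  rw [← Finset.mul_sum, Finset.sum_add_distrib, Finset.sum_add_distrib, hmid,
    Finset.sum_ite_eq', Finset.sum_ite_eq', if_pos hh, if_pos hk]
  field_simp
  ring

lemma Icc_restrict_right (n i : ℕ) (hi : 1 ≤ i) (f : ℕ → ℝ) :
    ∑ k ∈ Finset.Icc i n, f k = ∑ k ∈ Finset.Icc 1 n, if i ≤ k then f k else 0 := by
  rw [← Finset.sum_filter]
  congr 1
  ext k
  simp only [Finset.mem_filter, Finset.mem_Icc]
  omega

lemma Icc_restrict_left (n i : ℕ) (hi : i ≤ n) (f : ℕ → ℝ) :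
    ∑ k ∈ Finset.Icc 1 i, f k = ∑ k ∈ Finset.Icc 1 n, if k ≤ i then f k else 0 := by
  rw [← Finset.sum_filter]
  congr 1
  ext k
  simp only [Finset.mem_filter, Finset.mem_Icc]
  omega

lemma SCS_eq (n : ℕ) (T : ℕ → ℕ → ℝ) (hT : IsTollMatrix n T) (i : ℕ) (hi : i ∈ Finset.Icc 1 n) :
    SCS n T i = ∑ h ∈ Finset.Icc 1 n, ∑ k ∈ Finset.Icc 1 n, T h k * wgt n i h k := by
  obtain ⟨hi1, hin⟩ := Finset.mem_Icc.1 hi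
  have e1 : ∑ h ∈ Finset.Icc 1 n, ∑ k ∈ Finset.Icc 1 n, T h k * (if i = h then (i : ℝ) - 1 else 0)
      = ((i : ℝ) - 1) * ∑ k ∈ Finset.Icc i n, T i k := by
    rw [Finset.sum_eq_single_of_mem i hi]
    · rw [Icc_restrict_right n i hi1, Finset.mul_sum]
      refine Finset.sum_congr rfl fun k _ => ?_
      by_cases hk : i ≤ k
      · simp [hk, mul_comm]
      · simp [hk, hT.2.1 i k (by omega)]
    · intro h _ hne
      simp [hne.symm]
  have e3 : ∑ h ∈ Finset.Icc 1 n, ∑ k ∈ Finset.Icc 1 n, T h k * (if i = k then (n : ℝ) - i else 0)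
      = ((n : ℝ) - i) * ∑ h ∈ Finset.Icc 1 i, T h i := by
    rw [Finset.sum_comm, Finset.sum_eq_single_of_mem i hi]
    · rw [Icc_restrict_left n i hin, Finset.mul_sum]
      refine Finset.sum_congr rfl fun k _ => ?_
      by_cases hk : k ≤ i
      · simp [hk, mul_comm]
      · simp [hk, hT.2.1 k i (by omega)]
    · intro h _ hne
      simp [hne.symm]
  have e2 : ∑ h ∈ Finset.Icc 1 n, ∑ k ∈ Finset.Icc 1 n,
        T h k * (if h ≤ i ∧ i ≤ k then (1 : ℝ) else 0)
      = ∑ h ∈ Finset.Icc 1 i, ∑ k ∈ Finset.Icc i n, T h k := by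
    rw [Icc_restrict_left n i hin]
    refine Finset.sum_congr rfl fun h _ => ?_
    rw [Icc_restrict_right n i hi1]
    by_cases hh : h ≤ i <;> simp [hh]
  unfold SCS
  rw [← e1, ← e2, ← e3, ← Finset.sum_add_distrib, ← Finset.sum_add_distrib, Finset.mul_sum]
  refine Finset.sum_congr rfl fun h _ => ?_
  rw [← Finset.sum_add_distrib, ← Finset.sum_add_distrib, Finset.mul_sum]
  refine Finset.sum_congr rfl fun k _ => ?_
  unfold wgt
  ring

lemma SCS_sum (n : ℕ) (T : ℕ → ℕ → ℝ) (hT : IsTollMatrix n T) (S : Finset ℕ)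
    (hS : S ⊆ Finset.Icc 1 n) : ∑ i ∈ S, SCS n T i =
      ∑ h ∈ Finset.Icc 1 n, ∑ k ∈ Finset.Icc h n, T h k * ∑ i ∈ S, wgt n i h k := by
  rw [Finset.sum_congr rfl fun i hi => SCS_eq n T hT i (hS hi), Finset.sum_comm]
  refine Finset.sum_congr rfl fun h hh => ?_
  rw [Finset.sum_comm, Icc_restrict_right n h (Finset.mem_Icc.1 hh).1]
  refine Finset.sum_congr rfl fun k _ => ?_
  rw [← Finset.mul_sum]
  by_cases hk : h ≤ k
  · simp [hk]
  · simp [hk, hT.2.1 h k (by omega)]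

/-- The SCS allocation belongs to the core of the segments allocation game. -/
theorem SCS_in_core (n : ℕ) (hn : 1 ≤ n) (T : ℕ → ℕ → ℝ) (hT : IsTollMatrix n T) :
    InCore n (vSe n T) (SCS n T) := by
  constructor
  · rw [SCS_sum n T hT _ (Finset.Subset.refl _)]
    unfold vSe
    refine Finset.sum_congr rfl fun h hh => Finset.sum_congr rfl fun k hk => ?_
    rw [Finset.mem_Icc] at hh hk
    have hs : Finset.Icc h k ⊆ Finset.Icc 1 n := Finset.Icc_subset_Icc hh.1 hk.2
    rw [if_pos hs, wgt_sum n h k _ hn hk.1 hs, mul_one]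
  · intro S hS
    rw [SCS_sum n T hT S hS]
    unfold vSe
    refine Finset.sum_le_sum fun h hh => Finset.sum_le_sum fun k hk => ?_
    rw [Finset.mem_Icc] at hh hk
    split_ifs with hs
    · rw [wgt_sum n h k _ hn hk.1 hs, mul_one]
    · refine mul_nonneg (hT.1 h k) (Finset.sum_nonneg fun i hi => ?_)
      have := Finset.mem_Icc.1 (hS hi)
      exact wgt_nonneg n i h k this.1 this.2
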